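/- arXiv:1306.0895 — 9 statements merged into one kernel-verified Lean document; each statement's English description precedes it below -/
import Mathlib

section
/- For every d ≥ 1, every metric matrix M ∈ 𝓜, every α ≥ 0 and all x, y, z ∈ Σ_d, the Sinkhorn distance satisfies the triangle inequality: d_{M,α}(x,z) ≤ d_{M,α}(x,y) + d_{M,α}(y,z). -/
open Real BigOperators Finset

noncomputable section

/-- Transportation polytope `U(r,c)`: nonnegative matrices with row sums `r`, column sums `c`. -/
def transportPolytope {d : ℕ} (r c : Fin d → ℝ) : Set (Matrix (Fin d) (Fin d) ℝ) :=
  {P | (∀ i j, 0 ≤ P i j) ∧ (∀ i, ∑ j, P i j = r i) ∧ (∀ j, ∑ i, P i j = c j)}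

/-- Entropy of a histogram (with `0 log 0 = 0` since `Real.log 0 = 0`). -/
def entVec {d : ℕ} (r : Fin d → ℝ) : ℝ := -∑ i, r i * Real.log (r i)

/-- Entropy of a matrix. -/
def entMat {d : ℕ} (P : Matrix (Fin d) (Fin d) ℝ) : ℝ :=
  -∑ i, ∑ j, P i j * Real.log (P i j)

/-- Frobenius dot product `⟨P, M⟩`. -/
def frob {d : ℕ} (P M : Matrix (Fin d) (Fin d) ℝ) : ℝ := ∑ i, ∑ j, P i j * M i j

/-- `U_α(r,c)`: transportation plans with sufficient entropy. -/
def Ualpha {d : ℕ} (α : ℝ) (r c : Fin d → ℝ) : Set (Matrix (Fin d) (Fin d) ℝ) :=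
  {P ∈ transportPolytope r c | entVec r + entVec c - α ≤ entMat P}

/-- Sinkhorn distance `d_{M,α}(r,c) = min_{P ∈ U_α(r,c)} ⟨P,M⟩`. -/
def sinkhornDist {d : ℕ} (M : Matrix (Fin d) (Fin d) ℝ) (α : ℝ) (r c : Fin d → ℝ) : ℝ :=
  sInf ((fun P => frob P M) '' Ualpha α r c)

/-- The cone `𝓜` of metric matrices. -/
def IsMetricMatrix {d : ℕ} (M : Matrix (Fin d) (Fin d) ℝ) : Prop :=
  (∀ i j, 0 ≤ M i j) ∧ (∀ i, M i i = 0) ∧ (∀ i j k, M i j ≤ M i k + M k j)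

lemma ualpha_nonempty {d : ℕ} (α : ℝ) (hα : 0 ≤ α) (r c : Fin d → ℝ)
    (hr : r ∈ stdSimplex ℝ (Fin d)) (hc : c ∈ stdSimplex ℝ (Fin d)) :
    (Ualpha α r c).Nonempty := by
  refine ⟨fun i j => r i * c j, ⟨fun i j => mul_nonneg (hr.1 i) (hc.1 j), fun i => ?_, fun j => ?_⟩, ?_⟩
  · rw [← Finset.mul_sum, hc.2, mul_one]
  · rw [← Finset.sum_mul, hr.2, one_mul]
  · have key : ∀ i j, r i * c j * Real.log (r i * c j)
        = (r i * Real.log (r i)) * c j + r i * (c j * Real.log (c j)) := by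
      intro i j
      by_cases h1 : r i = 0
      · simp [h1]
      by_cases h2 : c j = 0
      · simp [h2]
      rw [Real.log_mul h1 h2]; ring
    unfold entMat entVec
    simp only [key, Finset.sum_add_distrib, ← Finset.mul_sum, ← Finset.sum_mul, hr.2, hc.2]
    linarith

lemma tp_zero {d : ℕ} {r c : Fin d → ℝ} {P : Matrix (Fin d) (Fin d) ℝ}
    (hP : P ∈ transportPolytope r c) {j : Fin d} (hj : c j = 0) (i : Fin d) : P i j = 0 := by
  have h := hP.2.2 j
  rw [hj] at h
  exact (Finset.sum_eq_zero_iff_of_nonneg (fun i _ => hP.1 i j)).1 h i (Finset.mem_univ i)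

lemma tp_zero_row {d : ℕ} {r c : Fin d → ℝ} {P : Matrix (Fin d) (Fin d) ℝ}
    (hP : P ∈ transportPolytope r c) {i : Fin d} (hi : r i = 0) (j : Fin d) : P i j = 0 := by
  have h := hP.2.1 i
  rw [hi] at h
  exact (Finset.sum_eq_zero_iff_of_nonneg (fun j _ => hP.1 i j)).1 h j (Finset.mem_univ j)

lemma cond_ent {d : ℕ} {r c : Fin d → ℝ} {P : Matrix (Fin d) (Fin d) ℝ}
    (hP : P ∈ transportPolytope r c) :
    ∑ i, ∑ j, c j * (P i j / c j * Real.log (P i j / c j)) = entVec c - entMat P := by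
  have key : ∀ i j, c j * (P i j / c j * Real.log (P i j / c j))
      = P i j * Real.log (P i j) - P i j * Real.log (c j) := by
    intro i j
    by_cases h1 : c j = 0
    · simp [h1, tp_zero hP h1]
    by_cases h2 : P i j = 0
    · simp [h2]
    rw [Real.log_div h2 h1]; field_simp
  simp only [key, Finset.sum_sub_distrib]
  rw [Finset.sum_comm (f := fun i j => P i j * Real.log (c j))]
  simp only [← Finset.sum_mul, hP.2.2]
  unfold entVec entMat
  ring

def glue {d : ℕ} (P Q : Matrix (Fin d) (Fin d) ℝ) (y : Fin d → ℝ) : Matrix (Fin d) (Fin d) ℝ :=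
  fun i k => ∑ j, P i j * Q j k / y j

lemma glue_tp {d : ℕ} {x y z : Fin d → ℝ} (hy : ∀ j, 0 ≤ y j) {P Q : Matrix (Fin d) (Fin d) ℝ}
    (hP : P ∈ transportPolytope x y) (hQ : Q ∈ transportPolytope y z) :
    glue P Q y ∈ transportPolytope x z := by
  refine ⟨fun i k => Finset.sum_nonneg fun j _ =>
    div_nonneg (mul_nonneg (hP.1 i j) (hQ.1 j k)) (hy j), fun i => ?_, fun k => ?_⟩
  · unfold glue
    rw [Finset.sum_comm, ← hP.2.1 i]
    refine Finset.sum_congr rfl fun j _ => ?_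
    rw [← Finset.sum_div, ← Finset.mul_sum, hQ.2.1 j]
    by_cases h : y j = 0
    · simp [h, tp_zero hP h]
    · field_simp
  · unfold glue
    rw [Finset.sum_comm, ← hQ.2.2 k]
    refine Finset.sum_congr rfl fun j _ => ?_
    rw [← Finset.sum_div, ← Finset.sum_mul, hP.2.2 j]
    by_cases h : y j = 0
    · simp [h, tp_zero_row hQ h]
    · field_simp

lemma glue_ent {d : ℕ} {x y z : Fin d → ℝ} (hy : ∀ j, 0 ≤ y j) (hz : ∀ j, 0 ≤ z j)
    {P Q : Matrix (Fin d) (Fin d) ℝ}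
    (hP : P ∈ transportPolytope x y) (hQ : Q ∈ transportPolytope y z) :
    entVec z - entMat (glue P Q y) ≤ entVec y - entMat P := by
  rw [← cond_ent hP, ← cond_ent (glue_tp hy hP hQ)]
  refine Finset.sum_le_sum fun i _ => ?_
  have h1 : ∀ k, z k * (glue P Q y i k / z k * Real.log (glue P Q y i k / z k))
      ≤ ∑ j, Q j k * (P i j / y j * Real.log (P i j / y j)) := by
    intro k
    by_cases h : z k = 0
    · simp [h, tp_zero hQ h]
    have hpos : 0 < z k := lt_of_le_of_ne (hz k) (Ne.symm h)
    have J := Real.convexOn_mul_log.map_sum_le (t := Finset.univ)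
      (w := fun j => Q j k / z k) (p := fun j => P i j / y j)
      (fun j _ => div_nonneg (hQ.1 j k) (hz k))
      (by rw [← Finset.sum_div, hQ.2.2 k, div_self h])
      (fun j _ => div_nonneg (hP.1 i j) (hy j))
    have e : ∑ j, (Q j k / z k) • (P i j / y j) = glue P Q y i k / z k := by
      unfold glue
      rw [Finset.sum_div]
      refine Finset.sum_congr rfl fun j _ => ?_
      rw [smul_eq_mul]; ring
    rw [e] at J
    refine (mul_le_mul_of_nonneg_left J hpos.le).trans (le_of_eq ?_)
    rw [Finset.mul_sum]
    refine Finset.sum_congr rfl fun j _ => ?_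
    rw [smul_eq_mul, ← mul_assoc, mul_div_cancel₀ _ h]
  refine (Finset.sum_le_sum fun k _ => h1 k).trans (le_of_eq ?_)
  rw [Finset.sum_comm]
  refine Finset.sum_congr rfl fun j _ => ?_
  rw [← Finset.sum_mul, hQ.2.1 j]

lemma glue_cost {d : ℕ} {x y z : Fin d → ℝ} (hy : ∀ j, 0 ≤ y j)
    {M P Q : Matrix (Fin d) (Fin d) ℝ} (hM : IsMetricMatrix M)
    (hP : P ∈ transportPolytope x y) (hQ : Q ∈ transportPolytope y z) :
    frob (glue P Q y) M ≤ frob P M + frob Q M := by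
  have h1 : frob (glue P Q y) M ≤ ∑ i, ∑ k, ∑ j,
      (P i j * Q j k / y j * M i j + P i j * Q j k / y j * M j k) := by
    unfold frob glue
    refine Finset.sum_le_sum fun i _ => Finset.sum_le_sum fun k _ => ?_
    rw [Finset.sum_mul]
    refine Finset.sum_le_sum fun j _ => ?_
    rw [← mul_add]
    exact mul_le_mul_of_nonneg_left (hM.2.2 i k j)
      (div_nonneg (mul_nonneg (hP.1 i j) (hQ.1 j k)) (hy j))
  refine h1.trans (le_of_eq ?_)
  simp only [Finset.sum_add_distrib]
  congr 1
  · unfold frob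
    refine Finset.sum_congr rfl fun i _ => ?_
    rw [Finset.sum_comm]
    refine Finset.sum_congr rfl fun j _ => ?_
    rw [← Finset.sum_mul, ← Finset.sum_div, ← Finset.mul_sum, hQ.2.1 j]
    by_cases h : y j = 0
    · simp [h, tp_zero hP h]
    · field_simp
  · unfold frob
    rw [Finset.sum_comm, Finset.sum_comm (f := fun i j => Q i j * M i j)]
    refine Finset.sum_congr rfl fun k _ => ?_
    rw [Finset.sum_comm]
    refine Finset.sum_congr rfl fun j _ => ?_
    rw [← Finset.sum_mul, ← Finset.sum_div, ← Finset.sum_mul, hP.2.2 j]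
    by_cases h : y j = 0
    · simp [h, tp_zero_row hQ h]
    · field_simp

/-- triangle inequality for the Sinkhorn distance. -/
theorem sinkhorn_triangle {d : ℕ} (hd : 1 ≤ d) (M : Matrix (Fin d) (Fin d) ℝ)
    (hM : IsMetricMatrix M) (α : ℝ) (hα : 0 ≤ α) (x y z : Fin d → ℝ)
    (hx : x ∈ stdSimplex ℝ (Fin d)) (hy : y ∈ stdSimplex ℝ (Fin d))
    (hz : z ∈ stdSimplex ℝ (Fin d)) :
    sinkhornDist M α x z ≤ sinkhornDist M α x y + sinkhornDist M α y z := by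
  have hbdd : BddBelow ((fun P => frob P M) '' Ualpha α x z) := by
    refine ⟨0, ?_⟩
    rintro _ ⟨P, hP, rfl⟩
    exact Finset.sum_nonneg fun i _ => Finset.sum_nonneg fun j _ =>
      mul_nonneg (hP.1.1 i j) (hM.1 i j)
  have main : ∀ P ∈ Ualpha α x y, ∀ Q ∈ Ualpha α y z,
      sinkhornDist M α x z ≤ frob P M + frob Q M := by
    intro P hP Q hQ
    refine (csInf_le hbdd ⟨glue P Q y, ⟨glue_tp hy.1 hP.1 hQ.1, ?_⟩, rfl⟩).trans
      (glue_cost hy.1 hM hP.1 hQ.1)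
    have h1 := glue_ent hy.1 hz.1 hP.1 hQ.1
    have h2 := hP.2
    linarith
  have h1 : sinkhornDist M α x z - sinkhornDist M α y z ≤ sinkhornDist M α x y := by
    refine le_csInf ((ualpha_nonempty α hα x y hx hy).image _) ?_
    rintro _ ⟨P, hP, rfl⟩
    have h2 : sinkhornDist M α x z - frob P M ≤ sinkhornDist M α y z := by
      refine le_csInf ((ualpha_nonempty α hα y z hy hz).image _) ?_
      rintro _ ⟨Q, hQ, rfl⟩
      have := main P hP Q hQ
      simp only
      linarith
    simp only
    linarith
  linarith
end
end

section
/- Let M ∈ 𝓜 be a symmetric metric matrix with m_{ij} > 0 whenever i ≠ j, and let α ≥ 0. Then the function ρ(r,c) := 1_{r≠c} · d_{M,α}(r,c) (which equals 0 if r = c and d_{M,α}(r,c) otherwise) is a metric on Σ_d: it is nonnegative, ρ(r,c) = 0 if and only if r = c, ρ is symmetric, and ρ satisfies the triangle inequality. -/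
open Real BigOperators Finset

noncomputable section

section helpers
variable {d : ℕ}

theorem aux_frob_nonneg (M : Matrix (Fin d) (Fin d) ℝ) (hM : ∀ i j, 0 ≤ M i j)
    {r c : Fin d → ℝ} {P : Matrix (Fin d) (Fin d) ℝ} (hP : P ∈ transportPolytope r c) :
    0 ≤ frob P M :=
  Finset.sum_nonneg fun i _ => Finset.sum_nonneg fun j _ => mul_nonneg (hP.1 i j) (hM i j)

theorem aux_bdd (M : Matrix (Fin d) (Fin d) ℝ) (hM : ∀ i j, 0 ≤ M i j) (α : ℝ)
    (r c : Fin d → ℝ) : BddBelow ((fun P => frob P M) '' Ualpha α r c) := by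
  refine ⟨0, ?_⟩
  rintro _ ⟨P, hP, rfl⟩
  exact aux_frob_nonneg M hM hP.1

theorem aux_nonempty (α : ℝ) (hα : 0 ≤ α) {r c : Fin d → ℝ}
    (hr : r ∈ stdSimplex ℝ (Fin d)) (hc : c ∈ stdSimplex ℝ (Fin d)) :
    (Ualpha α r c).Nonempty := by
  refine ⟨Matrix.of fun i j => r i * c j, ⟨?_, ?_, ?_⟩, ?_⟩
  · intro i j; exact mul_nonneg (hr.1 i) (hc.1 j)
  · intro i; simp [← Finset.mul_sum, hc.2]
  · intro j; simp [← Finset.sum_mul, hr.2]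
  · have key : ∀ i j, r i * c j * Real.log (r i * c j)
        = (r i * Real.log (r i)) * c j + r i * (c j * Real.log (c j)) := by
      intro i j
      by_cases h1 : r i = 0
      · simp [h1]
      by_cases h2 : c j = 0
      · simp [h2]
      rw [Real.log_mul h1 h2]; ring
    have : entMat (Matrix.of fun i j => r i * c j) = entVec r + entVec c := by
      simp only [entMat, entVec, Matrix.of_apply, key, Finset.sum_add_distrib, ← Finset.mul_sum,
        ← Finset.sum_mul, hr.2, hc.2]
      ring
    linarith

theorem aux_entMat_transpose (P : Matrix (Fin d) (Fin d) ℝ) : entMat P.transpose = entMat P := by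
  unfold entMat
  rw [Finset.sum_comm]; rfl

theorem aux_frob_transpose (P M : Matrix (Fin d) (Fin d) ℝ) (hs : ∀ i j, M i j = M j i) :
    frob P.transpose M = frob P M := by
  unfold frob
  rw [Finset.sum_comm]
  refine Finset.sum_congr rfl fun i _ => Finset.sum_congr rfl fun j _ => ?_
  rw [hs j i]; rfl

theorem aux_U_transpose {α : ℝ} {r c : Fin d → ℝ} {P : Matrix (Fin d) (Fin d) ℝ}
    (hP : P ∈ Ualpha α r c) : P.transpose ∈ Ualpha α c r := by
  refine ⟨⟨fun i j => hP.1.1 j i, hP.1.2.2, hP.1.2.1⟩, ?_⟩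
  rw [aux_entMat_transpose]
  have := hP.2
  linarith

theorem aux_symm (M : Matrix (Fin d) (Fin d) ℝ) (hs : ∀ i j, M i j = M j i) (α : ℝ)
    (r c : Fin d → ℝ) : sinkhornDist M α r c = sinkhornDist M α c r := by
  unfold sinkhornDist
  congr 1
  ext t
  constructor <;>
  · rintro ⟨P, hP, rfl⟩
    exact ⟨P.transpose, aux_U_transpose hP, aux_frob_transpose P M hs⟩

theorem aux_pos (M : Matrix (Fin d) (Fin d) ℝ) (hM : ∀ i j, 0 ≤ M i j)
    (hMpos : ∀ i j, i ≠ j → 0 < M i j) (α : ℝ) (hα : 0 ≤ α) {r c : Fin d → ℝ}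
    (hr : r ∈ stdSimplex ℝ (Fin d)) (hc : c ∈ stdSimplex ℝ (Fin d)) (i : Fin d)
    (hi : c i < r i) : 0 < sinkhornDist M α r c := by
  obtain ⟨δ, hδ, hδM⟩ : ∃ δ : ℝ, 0 < δ ∧ ∀ j, j ≠ i → δ ≤ M i j := by
    obtain ⟨k, _, hk⟩ := Finset.exists_min_image (Finset.univ : Finset (Fin d))
      (fun j => if j = i then 1 else M i j) ⟨i, Finset.mem_univ i⟩
    refine ⟨if k = i then 1 else M i k, ?_, ?_⟩
    · split_ifs with h
      · exact one_pos
      · exact hMpos _ _ (Ne.symm h)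
    · intro j hj
      have := hk j (Finset.mem_univ j)
      simpa [hj] using this
  refine lt_of_lt_of_le (mul_pos hδ (sub_pos.2 hi)) ?_
  refine le_csInf ((aux_nonempty α hα hr hc).image _) ?_
  rintro _ ⟨P, hP, rfl⟩
  have hP0 := hP.1.1
  have h1 : ∑ j, P i j * M i j ≤ frob P M :=
    Finset.single_le_sum (f := fun i => ∑ j, P i j * M i j)
      (fun i _ => Finset.sum_nonneg fun j _ => mul_nonneg (hP0 i j) (hM i j)) (Finset.mem_univ i)
  have h2 : P i i ≤ c i := by
    rw [← hP.1.2.2 i]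
    exact Finset.single_le_sum (f := fun k => P k i) (fun k _ => hP0 k i) (Finset.mem_univ i)
  have h3 : δ * (r i - P i i) ≤ ∑ j, P i j * M i j := by
    rw [← hP.1.2.1 i, ← Finset.add_sum_erase _ _ (Finset.mem_univ i),
      ← Finset.add_sum_erase _ (fun j => P i j * M i j) (Finset.mem_univ i), add_sub_cancel_left,
      Finset.mul_sum]
    have h4 : ∑ j ∈ Finset.univ.erase i, δ * P i j ≤ ∑ j ∈ Finset.univ.erase i, P i j * M i j := by
      refine Finset.sum_le_sum fun j hj => ?_
      rw [mul_comm]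
      exact mul_le_mul_of_nonneg_left (hδM j (Finset.ne_of_mem_erase hj)) (hP0 i j)
    have := mul_nonneg (hP0 i i) (hM i i)
    linarith
  have h5 : δ * (r i - c i) ≤ δ * (r i - P i i) := mul_le_mul_of_nonneg_left (by linarith) hδ.le
  show δ * (r i - c i) ≤ frob P M
  linarith

theorem aux_pos' (M : Matrix (Fin d) (Fin d) ℝ) (hM : ∀ i j, 0 ≤ M i j)
    (hs : ∀ i j, M i j = M j i)
    (hMpos : ∀ i j, i ≠ j → 0 < M i j) (α : ℝ) (hα : 0 ≤ α) {r c : Fin d → ℝ}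
    (hr : r ∈ stdSimplex ℝ (Fin d)) (hc : c ∈ stdSimplex ℝ (Fin d))
    (hne : r ≠ c) : 0 < sinkhornDist M α r c := by
  obtain ⟨i, hi⟩ := Function.ne_iff.1 hne
  rcases lt_or_gt_of_ne hi with h | h
  · rw [aux_symm M hs]
    exact aux_pos M hM hMpos α hα hc hr i h
  · exact aux_pos M hM hMpos α hα hr hc i h

theorem aux_point {P Q y z S : ℝ} (hP : 0 ≤ P) (hQ : 0 ≤ Q) (hy : 0 ≤ y)
    (hz : Q ≤ z) (hS : P * Q / y ≤ S) :
    P * Q / y * (Real.log S - Real.log z - Real.log P + Real.log y)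
      ≤ Q * S / z - P * Q / y := by
  have hT : 0 ≤ P * Q / y := by positivity
  rcases hT.eq_or_lt with h | h
  · rw [← h]
    have : 0 ≤ Q * S / z := div_nonneg (mul_nonneg hQ (hT.trans hS)) (hQ.trans hz)
    linarith
  · have hP' : 0 < P := hP.lt_of_ne (by rintro rfl; simp at h)
    have hQ' : 0 < Q := hQ.lt_of_ne (by rintro rfl; simp at h)
    have hy' : 0 < y := hy.lt_of_ne (by rintro rfl; simp at h)
    have hz' : 0 < z := hQ'.trans_le hz
    have hS' : 0 < S := h.trans_le hS
    have hl := Real.log_le_sub_one_of_pos (x := S * y / (z * P)) (by positivity)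
    rw [Real.log_div (by positivity) (by positivity), Real.log_mul hS'.ne' hy'.ne',
      Real.log_mul hz'.ne' hP'.ne'] at hl
    calc _ ≤ P * Q / y * (S * y / (z * P) - 1) := mul_le_mul_of_nonneg_left (by linarith) hT
      _ = _ := by field_simp

theorem aux_glue (M : Matrix (Fin d) (Fin d) ℝ) (hM : IsMetricMatrix M) {α : ℝ}
    {x y z : Fin d → ℝ} {P Q : Matrix (Fin d) (Fin d) ℝ} (hP : P ∈ Ualpha α x y)
    (hQ : Q ∈ Ualpha α y z) :
    ∃ S ∈ Ualpha α x z, frob S M ≤ frob P M + frob Q M := by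
  obtain ⟨⟨hP0, hPr, hPc⟩, hPe⟩ := hP
  obtain ⟨⟨hQ0, hQr, hQc⟩, -⟩ := hQ
  have hy : ∀ j, 0 ≤ y j := fun j => by rw [← hQr j]; exact Finset.sum_nonneg fun k _ => hQ0 j k
  have hPy : ∀ i j, P i j ≤ y j := fun i j => by
    rw [← hPc j]
    exact Finset.single_le_sum (f := fun i => P i j) (fun k _ => hP0 k j) (Finset.mem_univ i)
  have hQy : ∀ j k, Q j k ≤ y j := fun j k => by
    rw [← hQr j]
    exact Finset.single_le_sum (f := fun k => Q j k) (fun k _ => hQ0 j k) (Finset.mem_univ k)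
  have hQz : ∀ j k, Q j k ≤ z k := fun j k => by
    rw [← hQc k]
    exact Finset.single_le_sum (f := fun j => Q j k) (fun j _ => hQ0 j k) (Finset.mem_univ j)
  obtain ⟨T, hTdef⟩ : ∃ T : Fin d → Fin d → Fin d → ℝ, ∀ i j k, T i j k = P i j * Q j k / y j :=
    ⟨_, fun _ _ _ => rfl⟩
  have hT0 : ∀ i j k, 0 ≤ T i j k := fun i j k => by
    rw [hTdef]; exact div_nonneg (mul_nonneg (hP0 i j) (hQ0 j k)) (hy j)
  have hTk : ∀ i j, ∑ k, T i j k = P i j := fun i j => by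
    simp only [hTdef]
    rw [← Finset.sum_div, ← Finset.mul_sum, hQr]
    by_cases h : y j = 0
    · have h1 := hPy i j
      have h2 := hP0 i j
      rw [h] at h1 ⊢
      simp; linarith
    · field_simp
  have hTi : ∀ j k, ∑ i, T i j k = Q j k := fun j k => by
    simp only [hTdef]
    rw [← Finset.sum_div, ← Finset.sum_mul, hPc]
    by_cases h : y j = 0
    · have h1 := hQy j k
      have h2 := hQ0 j k
      rw [h] at h1 ⊢
      simp; linarith
    · field_simp
  obtain ⟨S, hSdef⟩ : ∃ S : Matrix (Fin d) (Fin d) ℝ, ∀ i k, S i k = ∑ j, T i j k :=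
    ⟨fun i k => ∑ j, T i j k, fun _ _ => rfl⟩
  have hTS : ∀ i j k, T i j k ≤ S i k := fun i j k => by
    rw [hSdef]
    exact Finset.single_le_sum (f := fun j => T i j k) (fun j _ => hT0 i j k) (Finset.mem_univ j)
  have hS0 : ∀ i k, 0 ≤ S i k := fun i k => by
    rw [hSdef]; exact Finset.sum_nonneg fun j _ => hT0 i j k
  have hSr : ∀ i, ∑ k, S i k = x i := fun i => by
    simp only [hSdef]
    rw [Finset.sum_comm]; simp only [hTk, hPr]
  have hSc : ∀ k, ∑ i, S i k = z k := fun k => by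
    simp only [hSdef]
    rw [Finset.sum_comm]; simp only [hTi, hQc]
  -- triple sums
  have tP : ∀ f : Fin d → Fin d → ℝ,
      ∑ i, ∑ j, ∑ k, T i j k * f i j = ∑ i, ∑ j, P i j * f i j := fun f => by
    simp only [← Finset.sum_mul, hTk]
  have tS : ∀ f : Fin d → Fin d → ℝ,
      ∑ i, ∑ j, ∑ k, T i j k * f i k = ∑ i, ∑ k, S i k * f i k := fun f => by
    refine Finset.sum_congr rfl fun i _ => ?_
    rw [Finset.sum_comm]
    simp only [← Finset.sum_mul, hSdef]
  have tQ : ∀ f : Fin d → Fin d → ℝ,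
      ∑ i, ∑ j, ∑ k, T i j k * f j k = ∑ j, ∑ k, Q j k * f j k := fun f => by
    rw [Finset.sum_comm]
    refine Finset.sum_congr rfl fun j _ => ?_
    rw [Finset.sum_comm]
    simp only [← Finset.sum_mul, hTi]
  refine ⟨S, ⟨⟨hS0, hSr, hSc⟩, ?_⟩, ?_⟩
  · have hsum : ∑ i, ∑ j, ∑ k, T i j k *
          (Real.log (S i k) - Real.log (z k) - Real.log (P i j) + Real.log (y j))
        ≤ ∑ i, ∑ j, ∑ k, (Q j k * S i k / z k - T i j k) := by
      refine Finset.sum_le_sum fun i _ => Finset.sum_le_sum fun j _ =>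
        Finset.sum_le_sum fun k _ => ?_
      have := hTS i j k
      rw [hTdef] at this ⊢
      exact aux_point (hP0 i j) (hQ0 j k) (hy j) (hQz j k) this
    have hz : ∑ i, ∑ j, ∑ k, (Q j k * S i k / z k - T i j k) = 0 := by
      refine Finset.sum_eq_zero fun i _ => ?_
      rw [Finset.sum_comm]
      refine Finset.sum_eq_zero fun k _ => ?_
      rw [Finset.sum_sub_distrib, ← hSdef, ← Finset.sum_div, ← Finset.sum_mul, hQc]
      by_cases h : z k = 0
      · have : S i k ≤ z k := by
          rw [← hSc k]
          exact Finset.single_le_sum (f := fun i => S i k) (fun i _ => hS0 i k) (Finset.mem_univ i)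
        have h2 := hS0 i k
        rw [h] at this ⊢
        simp; linarith
      · field_simp; simp
    rw [hz] at hsum
    simp only [mul_add, mul_sub, Finset.sum_add_distrib, Finset.sum_sub_distrib] at hsum
    rw [tS (fun i k => Real.log (S i k)), tS (fun i k => Real.log (z k)),
      tP (fun i j => Real.log (P i j)), tP (fun i j => Real.log (y j))] at hsum
    rw [Finset.sum_comm (f := fun i k => S i k * Real.log (z k)),
      Finset.sum_comm (f := fun i j => P i j * Real.log (y j))] at hsum
    simp only [← Finset.sum_mul, hSc, hPc] at hsum
    unfold entMat entVec at *
    linarith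
  · have e1 : frob S M = ∑ i, ∑ j, ∑ k, T i j k * M i k := (tS fun i k => M i k).symm
    have e2 : frob P M = ∑ i, ∑ j, ∑ k, T i j k * M i j := (tP fun i k => M i k).symm
    have e3 : frob Q M = ∑ i, ∑ j, ∑ k, T i j k * M j k := (tQ fun i k => M i k).symm
    rw [e1, e2, e3]
    simp only [← Finset.sum_add_distrib, ← mul_add]
    exact Finset.sum_le_sum fun i _ => Finset.sum_le_sum fun j _ =>
        Finset.sum_le_sum fun k _ => mul_le_mul_of_nonneg_left (hM.2.2 i k j) (hT0 i j k)

theorem aux_tri (M : Matrix (Fin d) (Fin d) ℝ) (hM : IsMetricMatrix M) (α : ℝ) (hα : 0 ≤ α)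
    {x y z : Fin d → ℝ} (hx : x ∈ stdSimplex ℝ (Fin d)) (hy : y ∈ stdSimplex ℝ (Fin d))
    (hz : z ∈ stdSimplex ℝ (Fin d)) :
    sinkhornDist M α x z ≤ sinkhornDist M α x y + sinkhornDist M α y z := by
  have h : ∀ P ∈ Ualpha α x y, ∀ Q ∈ Ualpha α y z,
      sinkhornDist M α x z ≤ frob P M + frob Q M := fun P hP Q hQ => by
    obtain ⟨S, hS, hle⟩ := aux_glue M hM hP hQ
    exact (csInf_le (aux_bdd M hM.1 α x z) ⟨S, hS, rfl⟩).trans hle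
  have h1 : ∀ P ∈ Ualpha α x y, sinkhornDist M α x z - frob P M ≤ sinkhornDist M α y z := by
    intro P hP
    refine le_csInf ((aux_nonempty α hα hy hz).image _) ?_
    rintro _ ⟨Q, hQ, rfl⟩
    have := h P hP Q hQ
    show _ ≤ frob Q M
    linarith
  have h2 : sinkhornDist M α x z - sinkhornDist M α y z ≤ sinkhornDist M α x y := by
    refine le_csInf ((aux_nonempty α hα hx hy).image _) ?_
    rintro _ ⟨P, hP, rfl⟩
    have := h1 P hP
    show _ ≤ frob P M
    linarith
  linarith

end helpers

/-- `ρ(r,c) = 1_{r≠c} d_{M,α}(r,c)` is a metric on the simplex. -/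
theorem sinkhorn_indicator_is_metric {d : ℕ} (M : Matrix (Fin d) (Fin d) ℝ)
    (hM : IsMetricMatrix M) (hMsymm : ∀ i j, M i j = M j i)
    (hMpos : ∀ i j, i ≠ j → 0 < M i j) (α : ℝ) (hα : 0 ≤ α)
    (ρ : (Fin d → ℝ) → (Fin d → ℝ) → ℝ)
    (hρ : ∀ r c, ρ r c = if r = c then 0 else sinkhornDist M α r c) :
    (∀ r ∈ stdSimplex ℝ (Fin d), ∀ c ∈ stdSimplex ℝ (Fin d), 0 ≤ ρ r c) ∧
    (∀ r ∈ stdSimplex ℝ (Fin d), ∀ c ∈ stdSimplex ℝ (Fin d), (ρ r c = 0 ↔ r = c)) ∧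
    (∀ r ∈ stdSimplex ℝ (Fin d), ∀ c ∈ stdSimplex ℝ (Fin d), ρ r c = ρ c r) ∧
    (∀ x ∈ stdSimplex ℝ (Fin d), ∀ y ∈ stdSimplex ℝ (Fin d), ∀ z ∈ stdSimplex ℝ (Fin d),
      ρ x z ≤ ρ x y + ρ y z) := by
  have hnn : ∀ r ∈ stdSimplex ℝ (Fin d), ∀ c ∈ stdSimplex ℝ (Fin d), 0 ≤ ρ r c := by
    intro r hr c hc
    rw [hρ]
    split_ifs with h
    · exact le_rfl
    · exact (aux_pos' M hM.1 hMsymm hMpos α hα hr hc h).le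
  refine ⟨hnn, ?_, ?_, ?_⟩
  · intro r hr c hc
    rw [hρ]
    split_ifs with h
    · simp [h]
    · simp [h, (aux_pos' M hM.1 hMsymm hMpos α hα hr hc h).ne']
  · intro r _ c _
    rw [hρ, hρ, aux_symm M hMsymm]
    simp only [eq_comm]
  · intro x hx y hy z hz
    by_cases hxz : x = z
    · have h1 := hnn x hx y hy
      have h2 := hnn y hy z hz
      rw [hρ x z, if_pos hxz]
      linarith
    by_cases hxy : x = y
    · subst hxy
      simp [hρ x x]
    by_cases hyz : y = z
    · subst hyz
      simp [hρ y y]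
    rw [hρ, hρ, hρ, if_neg hxz, if_neg hxy, if_neg hyz]
    exact aux_tri M hM α hα hx hy hz
end
end

section
/- (Gluing Lemma with Entropic Constraint) Let α ≥ 0, let x, y, z ∈ Σ_d, let P ∈ U_α(x,y) and Q ∈ U_α(y,z), and let S be the d×d matrix with entries s_{ik} = Σ_{j : y_j > 0} p_{ij} q_{jk} / y_j. Then S ∈ U_α(x,z); that is, S has row sums x and column sums z and satisfies h(S) ≥ h(x) + h(z) - α. -/
open Real BigOperators Finset

noncomputable section

theorem aux_condEnt {d : ℕ} (A : Matrix (Fin d) (Fin d) ℝ) (c : Fin d → ℝ)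
    (h0 : ∀ i j, 0 ≤ A i j) (hc : ∀ j, ∑ i, A i j = c j) :
    ∑ i, ∑ j, A i j * Real.log (A i j) - ∑ j, c j * Real.log (c j)
      = ∑ i, ∑ j, c j * ((A i j / c j) * Real.log (A i j / c j)) := by
  have h1 : ∑ j, c j * Real.log (c j) = ∑ i, ∑ j, A i j * Real.log (c j) := by
    rw [Finset.sum_comm]
    refine Finset.sum_congr rfl fun j _ => ?_
    rw [← Finset.sum_mul, hc]
  rw [h1, ← Finset.sum_sub_distrib]
  refine Finset.sum_congr rfl fun i _ => ?_
  rw [← Finset.sum_sub_distrib]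
  refine Finset.sum_congr rfl fun j _ => ?_
  have hle : A i j ≤ c j := by
    rw [← hc j]
    exact Finset.single_le_sum (f := fun i => A i j) (fun i _ => h0 i j) (Finset.mem_univ i)
  rcases (h0 i j).eq_or_lt with h | h
  · simp [← h]
  · have hcp : 0 < c j := h.trans_le hle
    rw [Real.log_div h.ne' hcp.ne']
    field_simp

theorem aux_zero {d : ℕ} (f : Fin d → ℝ) (s : ℝ) (h0 : ∀ i, 0 ≤ f i) (hs : ∑ i, f i = s)
    (h : s = 0) (i : Fin d) : f i = 0 := by
  rw [h] at hs
  exact (Finset.sum_eq_zero_iff_of_nonneg (fun i _ => h0 i)).1 hs i (Finset.mem_univ i)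

/-- gluing lemma with entropic constraint. -/
theorem gluing_with_entropic_constraint {d : ℕ} (α : ℝ) (hα : 0 ≤ α)
    (x y z : Fin d → ℝ)
    (hx : x ∈ stdSimplex ℝ (Fin d)) (hy : y ∈ stdSimplex ℝ (Fin d))
    (hz : z ∈ stdSimplex ℝ (Fin d))
    (P Q S : Matrix (Fin d) (Fin d) ℝ)
    (hP : P ∈ Ualpha α x y) (hQ : Q ∈ Ualpha α y z)
    (hS : ∀ i k, S i k = ∑ j ∈ Finset.univ.filter (fun j => 0 < y j), P i j * Q j k / y j) :
    S ∈ Ualpha α x z := by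
  obtain ⟨⟨P0, Pr, Pc⟩, Pe⟩ := hP
  obtain ⟨⟨Q0, Qr, Qc⟩, Qe⟩ := hQ
  have hS' : ∀ i k, S i k = ∑ j, P i j * Q j k / y j := by
    intro i k
    rw [hS, Finset.sum_filter]
    refine Finset.sum_congr rfl fun j _ => ?_
    split_ifs with h
    · rfl
    · have : y j = 0 := le_antisymm (not_lt.1 h) (hy.1 j)
      simp [this]
  have S0 : ∀ i k, 0 ≤ S i k := by
    intro i k
    rw [hS']
    exact Finset.sum_nonneg fun j _ => div_nonneg (mul_nonneg (P0 i j) (Q0 j k)) (hy.1 j)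
  have Sr : ∀ i, ∑ k, S i k = x i := by
    intro i
    simp_rw [hS']
    rw [Finset.sum_comm, ← Pr i]
    refine Finset.sum_congr rfl fun j _ => ?_
    rw [← Finset.sum_div, ← Finset.mul_sum, Qr]
    by_cases h : y j = 0
    · simp [aux_zero (fun i => P i j) (y j) (fun i => P0 i j) (Pc j) h i, h]
    · field_simp
  have Sc : ∀ k, ∑ i, S i k = z k := by
    intro k
    simp_rw [hS']
    rw [Finset.sum_comm, ← Qc k]
    refine Finset.sum_congr rfl fun j _ => ?_
    rw [← Finset.sum_div, ← Finset.sum_mul, Pc]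
    by_cases h : y j = 0
    · simp [aux_zero (fun i => Q j i) (y j) (fun i => Q0 j i) (Qr j) h k, h]
    · field_simp
  refine ⟨⟨S0, Sr, Sc⟩, ?_⟩
  have hPe := aux_condEnt P y P0 Pc
  have hSe := aux_condEnt S z S0 Sc
  have key : ∑ i, ∑ k, z k * ((S i k / z k) * Real.log (S i k / z k))
      ≤ ∑ i, ∑ j, y j * ((P i j / y j) * Real.log (P i j / y j)) := by
    refine Finset.sum_le_sum fun i _ => ?_
    have hR : ∑ j, y j * ((P i j / y j) * Real.log (P i j / y j))
        = ∑ k, ∑ j, Q j k * ((P i j / y j) * Real.log (P i j / y j)) := by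
      rw [Finset.sum_comm]
      refine Finset.sum_congr rfl fun j _ => ?_
      rw [← Finset.sum_mul, Qr]
    rw [hR]
    refine Finset.sum_le_sum fun k _ => ?_
    rcases (hz.1 k).eq_or_lt with h | h
    · have : ∀ j, Q j k = 0 := aux_zero (fun j => Q j k) (z k) (fun j => Q0 j k) (Qc k) h.symm
      simp [← h, this]
    · have hJ := Real.convexOn_mul_log.map_sum_le (t := Finset.univ)
        (w := fun j => Q j k / z k) (p := fun j => P i j / y j)
        (fun j _ => div_nonneg (Q0 j k) h.le)
        (by rw [← Finset.sum_div, Qc, div_self h.ne'])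
        (fun j _ => div_nonneg (P0 i j) (hy.1 j))
      have hSs : ∑ j, (Q j k / z k) • (P i j / y j) = S i k / z k := by
        rw [hS', Finset.sum_div]
        refine Finset.sum_congr rfl fun j _ => ?_
        rw [smul_eq_mul]; ring
      rw [hSs] at hJ
      refine (mul_le_mul_of_nonneg_left hJ h.le).trans_eq ?_
      rw [Finset.mul_sum]
      refine Finset.sum_congr rfl fun j _ => ?_
      rw [smul_eq_mul, ← mul_assoc, mul_div_cancel₀ _ h.ne']
  simp only [entVec, entMat] at *
  linarith
end
end

section
/- For all r, c ∈ Σ_d and every α ≥ (h(r) + h(c))/2, one has U_α(r,c) = U(r,c); consequently, for any d×d matrix M with nonnegative entries, d_{M,α}(r,c) = d_M(r,c), i.e. for α large enough the Sinkhorn distance coincides with the classical optimal transportation distance. -/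
open Real BigOperators Finset

noncomputable section

theorem aux_row {d : ℕ} (f : Fin d → ℝ) (hf : ∀ j, 0 ≤ f j) (a : ℝ) (ha : ∑ j, f j = a) :
    ∑ j, f j * Real.log (f j) ≤ a * Real.log a := by
  calc ∑ j, f j * Real.log (f j) ≤ ∑ j, f j * Real.log a := by
        apply Finset.sum_le_sum
        intro j _
        rcases (hf j).eq_or_lt with h | h
        · simp [← h]
        · apply mul_le_mul_of_nonneg_left _ h.le
          apply Real.log_le_log h
          rw [← ha]
          exact Finset.single_le_sum (fun k _ => hf k) (Finset.mem_univ j)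
    _ = a * Real.log a := by rw [← Finset.sum_mul, ha]

theorem aux_ent {d : ℕ} (r c : Fin d → ℝ) (P : Matrix (Fin d) (Fin d) ℝ)
    (hP : P ∈ transportPolytope r c) : entVec r ≤ entMat P ∧ entVec c ≤ entMat P := by
  obtain ⟨h0, h1, h2⟩ := hP
  unfold entVec entMat
  constructor
  · apply neg_le_neg
    exact Finset.sum_le_sum fun i _ => aux_row (fun j => P i j) (h0 i) _ (h1 i)
  · apply neg_le_neg
    rw [Finset.sum_comm]
    exact Finset.sum_le_sum fun j _ => aux_row (fun i => P i j) (fun i => h0 i j) _ (h2 j)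

/-- for `α ≥ (h(r)+h(c))/2`, `U_α(r,c) = U(r,c)` and the Sinkhorn distance
coincides with the classical optimal transportation distance. -/
theorem sinkhorn_eq_emd_of_large_alpha {d : ℕ} (r c : Fin d → ℝ)
    (hr : r ∈ stdSimplex ℝ (Fin d)) (hc : c ∈ stdSimplex ℝ (Fin d))
    (α : ℝ) (hα : (entVec r + entVec c) / 2 ≤ α) :
    Ualpha α r c = transportPolytope r c ∧
    ∀ M : Matrix (Fin d) (Fin d) ℝ, (∀ i j, 0 ≤ M i j) →
      sinkhornDist M α r c = sInf ((fun P => frob P M) '' transportPolytope r c) := by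
  have key : Ualpha α r c = transportPolytope r c := by
    ext P
    refine ⟨fun h => h.1, fun h => ⟨h, ?_⟩⟩
    obtain ⟨h1, h2⟩ := aux_ent r c P h
    linarith
  exact ⟨key, fun M _ => by unfold sinkhornDist; rw [key]⟩
end
end

section
/- (Independence kernel) Suppose M is a Euclidean distance matrix, i.e. there exist vectors φ_1, ..., φ_d in some ℝ^n with m_{ij} = ‖φ_i − φ_j‖²₂ for all i, j. Then for every t > 0 and every finite family r_1, ..., r_N ∈ Σ_d, the N×N matrix with entries exp(−t · r_kᵀ M r_l) is positive semidefinite. -/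
open Real BigOperators Finset

noncomputable section

lemma aux_pow {N : ℕ} {A : Matrix (Fin N) (Fin N) ℝ} (hA : A.PosSemidef) (m : ℕ) :
    (Matrix.of fun k l => A k l ^ m).PosSemidef := by
  induction m with
  | zero =>
    have h := Matrix.posSemidef_vecMulVec_self_star (fun _ : Fin N => (1 : ℝ))
    convert h using 1
    ext k l
    simp [Matrix.vecMulVec_apply]
  | succ m ih =>
    have h := ih.hadamard hA
    have e : (Matrix.of fun k l => A k l ^ (m + 1))
        = (Matrix.of fun k l => A k l ^ m).hadamard A := by
      ext k l
      simp [pow_succ]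
    rw [e]
    exact h

lemma aux_exp {N : ℕ} {A : Matrix (Fin N) (Fin N) ℝ} (hA : A.PosSemidef) (y : Fin N → ℝ) :
    0 ≤ ∑ k, ∑ l, y k * Real.exp (A k l) * y l := by
  have h1 : HasSum (fun m : ℕ => ∑ k, ∑ l, y k * (A k l ^ m / (m.factorial : ℝ)) * y l)
      (∑ k, ∑ l, y k * Real.exp (A k l) * y l) := by
    refine hasSum_sum fun k _ => hasSum_sum fun l _ => ?_
    refine HasSum.mul_right _ (HasSum.mul_left _ ?_)
    rw [Real.exp_eq_exp_ℝ]
    exact NormedSpace.expSeries_div_hasSum_exp (A k l)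
  refine h1.nonneg fun m => ?_
  have h2 := (aux_pow hA m).dotProduct_mulVec_nonneg y
  have h3 : ∑ k, ∑ l, y k * (A k l ^ m / (m.factorial : ℝ)) * y l
      = (∑ k, ∑ l, y k * (A k l ^ m) * y l) / (m.factorial : ℝ) := by
    simp only [Finset.sum_div]
    refine Finset.sum_congr rfl fun k _ => Finset.sum_congr rfl fun l _ => ?_
    ring
  rw [h3]
  refine div_nonneg ?_ (by positivity)
  simpa [dotProduct, Matrix.mulVec, Finset.mul_sum, mul_assoc] using h2

lemma aux_expand {d n : ℕ} (φ : Fin d → EuclideanSpace ℝ (Fin n)) (p q : Fin d → ℝ)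
    (hp : ∑ i, p i = 1) (hq : ∑ i, q i = 1) :
    ∑ i, ∑ j, p i * ‖φ i - φ j‖ ^ 2 * q j
      = (∑ i, p i * ‖φ i‖ ^ 2) + (∑ j, q j * ‖φ j‖ ^ 2)
        - 2 * inner ℝ (∑ i, p i • φ i) (∑ j, q j • φ j) := by
  have e1 : ∑ i, p i * ‖φ i‖ ^ 2 = ∑ i, ∑ j, p i * ‖φ i‖ ^ 2 * q j := by
    simp only [← Finset.mul_sum, hq, mul_one]
  have e2 : ∑ j, q j * ‖φ j‖ ^ 2 = ∑ i, ∑ j, p i * (q j * ‖φ j‖ ^ 2) := by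
    simp only [← Finset.mul_sum, ← Finset.sum_mul, hp, one_mul]
  have e3 : inner ℝ (∑ i, p i • φ i) (∑ j, q j • φ j)
      = ∑ i, ∑ j, p i * (q j * inner ℝ (φ i) (φ j)) := by
    simp only [sum_inner, inner_sum, real_inner_smul_left, real_inner_smul_right]
    rw [Finset.sum_comm]
    refine Finset.sum_congr rfl fun i _ => Finset.sum_congr rfl fun j _ => ?_
    ring
  rw [e1, e2, e3, Finset.mul_sum, ← Finset.sum_add_distrib, ← Finset.sum_sub_distrib]
  refine Finset.sum_congr rfl fun i _ => ?_
  rw [Finset.mul_sum, ← Finset.sum_add_distrib, ← Finset.sum_sub_distrib]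
  refine Finset.sum_congr rfl fun j _ => ?_
  rw [norm_sub_sq_real]
  ring

/-- the independence kernel `exp(-t · rᵀ M c)` is positive definite:
every Gram-type matrix built from it is positive semidefinite. -/
theorem independence_kernel_posSemidef {d n : ℕ}
    (M : Matrix (Fin d) (Fin d) ℝ) (φ : Fin d → EuclideanSpace ℝ (Fin n))
    (hM : ∀ i j, M i j = ‖φ i - φ j‖ ^ 2)
    (t : ℝ) (ht : 0 < t)
    (N : ℕ) (r : Fin N → Fin d → ℝ) (hr : ∀ k, r k ∈ stdSimplex ℝ (Fin d)) :
    (Matrix.of fun k l : Fin N =>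
        Real.exp (-t * ∑ i, ∑ j, r k i * M i j * r l j)).PosSemidef := by
  set u : Fin N → EuclideanSpace ℝ (Fin n) := fun k => ∑ i, r k i • φ i with hu
  set a : Fin N → ℝ := fun k => ∑ i, r k i * ‖φ i‖ ^ 2 with ha
  have hG : ((2 * t) • Matrix.gram ℝ u).PosSemidef :=
    (Matrix.posSemidef_gram ℝ u).smul (by positivity)
  have key : ∀ k l, Real.exp (-t * ∑ i, ∑ j, r k i * M i j * r l j)
      = Real.exp (-t * a k) * Real.exp (((2 * t) • Matrix.gram ℝ u) k l) * Real.exp (-t * a l) := by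
    intro k l
    rw [← Real.exp_add, ← Real.exp_add]
    simp only [hM]
    rw [aux_expand φ (r k) (r l) (hr k).2 (hr l).2]
    congr 1
    simp only [Matrix.smul_apply, Matrix.gram_apply, smul_eq_mul, hu, ha]
    ring
  refine Matrix.PosSemidef.of_dotProduct_mulVec_nonneg ?_ fun x => ?_
  · ext k l
    simp only [Matrix.conjTranspose_apply, Matrix.of_apply, star_trivial, key]
    have := hG.1.apply l k
    simp only [star_trivial] at this
    rw [this]
    ring
  · have h := aux_exp hG (fun k => Real.exp (-t * a k) * x k)
    refine h.trans_eq ?_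
    simp only [dotProduct, Matrix.mulVec, Matrix.of_apply, key, Pi.star_apply, star_trivial]
    simp only [Finset.mul_sum]
    refine Finset.sum_congr rfl fun k _ => Finset.sum_congr rfl fun l _ => ?_
    ring
end
end

section
/- Let M be a d×d real matrix, let λ > 0, and let r, c ∈ Σ_d have strictly positive entries. Then the unique minimizer P^λ of P ↦ ⟨P,M⟩ − (1/λ) h(P) over U(r,c) has strictly positive entries and is a diagonal scaling of the matrix e^{−λM}: there exist vectors u, v ∈ ℝ^d with strictly positive entries such that p^λ_{ij} = u_i e^{−λ m_{ij}} v_j for all i, j, i.e. P^λ = diag(u) e^{−λM} diag(v) where e^{−λM} denotes the entrywise exponential. -/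
open Real BigOperators Finset

noncomputable section

theorem aux_tangent (x y : ℝ) (hx : 0 ≤ x) (hy : 0 < y) :
    y * Real.log y - x * Real.log x ≤ (Real.log y + 1) * (y - x) := by
  rcases hx.eq_or_lt with h | h
  · subst h
    simp
    nlinarith
  · have h1 := Real.log_le_sub_one_of_pos (div_pos hy h)
    rw [Real.log_div hy.ne' h.ne'] at h1
    have h2 := mul_le_mul_of_nonneg_left h1 h.le
    have h3 : x * (y / x - 1) = y - x := by field_simp
    rw [h3] at h2
    nlinarith

def auxD {d : ℕ} (i k j l p q : Fin d) : ℝ :=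
  ((if p = i then 1 else 0) - (if p = k then 1 else 0)) *
    ((if q = j then 1 else 0) - (if q = l then 1 else 0))

theorem auxD_row {d : ℕ} (i k j l p : Fin d) : ∑ q, auxD i k j l p q = 0 := by
  simp [auxD, ← Finset.mul_sum]

theorem auxD_col {d : ℕ} (i k j l q : Fin d) : ∑ p, auxD i k j l p q = 0 := by
  simp [auxD, ← Finset.sum_mul]

theorem auxD_sum {d : ℕ} (i k j l : Fin d) (G : Fin d → Fin d → ℝ) :
    ∑ p, ∑ q, auxD i k j l p q * G p q = G i j - G i l - G k j + G k l := by
  simp only [auxD, mul_assoc, ← Finset.mul_sum]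
  simp [sub_mul, Finset.sum_sub_distrib]
  ring

theorem aux_step {d : ℕ}
    (M : Matrix (Fin d) (Fin d) ℝ) (lam : ℝ) (hlam : 0 < lam)
    (r c : Fin d → ℝ)
    (P : Matrix (Fin d) (Fin d) ℝ)
    (hPmem : P ∈ transportPolytope r c)
    (hPmin : ∀ Q ∈ transportPolytope r c,
      frob P M - (1 / lam) * entMat P ≤ frob Q M - (1 / lam) * entMat Q)
    (i k j l : Fin d) (hik : i ≠ k) (hjl : j ≠ l)
    (t : ℝ) (ht : 0 < t) (hta : t < P i l) (htb : t < P k j) :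
    (P i l - t) * (P k j - t) * Real.exp (lam * (M i l + M k j)) ≤
      (P i j + t) * (P k l + t) * Real.exp (lam * (M i j + M k l)) := by
  obtain ⟨h0, hrow, hcol⟩ := hPmem
  set Q : Matrix (Fin d) (Fin d) ℝ := fun p q => P p q + t * auxD i k j l p q with hQ
  have e1 : Q i j = P i j + t := by simp [hQ, auxD, hik, hjl]
  have e2 : Q k l = P k l + t := by simp [hQ, auxD, hik.symm, hjl.symm]
  have e3 : Q i l = P i l - t := by simp [hQ, auxD, hik, hjl.symm]; ring
  have e4 : Q k j = P k j - t := by simp [hQ, auxD, hik.symm, hjl]; ring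
  have p1 : 0 < Q i j := by rw [e1]; linarith [h0 i j]
  have p2 : 0 < Q k l := by rw [e2]; linarith [h0 k l]
  have p3 : 0 < Q i l := by rw [e3]; linarith
  have p4 : 0 < Q k j := by rw [e4]; linarith
  have key : ∀ p q, 0 < Q p q ∨ auxD i k j l p q = 0 := by
    intro p q
    by_cases hp : p = i
    · by_cases hq : q = j
      · subst hp hq; exact Or.inl p1
      · by_cases hq' : q = l
        · subst hp hq'; exact Or.inl p3
        · right; simp [auxD, hq, hq']
    · by_cases hp' : p = k
      · by_cases hq : q = j
        · subst hp' hq; exact Or.inl p4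
        · by_cases hq' : q = l
          · subst hp' hq'; exact Or.inl p2
          · right; simp [auxD, hq, hq']
      · right; simp [auxD, hp, hp']
  have hQmem : Q ∈ transportPolytope r c := by
    refine ⟨fun p q => ?_, fun p => ?_, fun q => ?_⟩
    · rcases key p q with h | h
      · exact h.le
      · simp only [hQ, h]; simpa using h0 p q
    · simp only [hQ, Finset.sum_add_distrib, ← Finset.mul_sum, auxD_row, hrow]; simp
    · simp only [hQ, Finset.sum_add_distrib, ← Finset.mul_sum, auxD_col, hcol]; simp
  have hmin := hPmin Q hQmem
  have hobj : ∀ R : Matrix (Fin d) (Fin d) ℝ, lam * (frob R M - (1 / lam) * entMat R) =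
      ∑ p, ∑ q, (lam * (R p q * M p q) + R p q * Real.log (R p q)) := by
    intro R
    simp only [frob, entMat, Finset.sum_add_distrib, ← Finset.mul_sum]
    field_simp
    ring
  have h1 := mul_le_mul_of_nonneg_left hmin hlam.le
  rw [hobj, hobj] at h1
  have h2 : ∑ p, ∑ q, (lam * (Q p q * M p q) + Q p q * Real.log (Q p q)) ≤
      ∑ p, ∑ q, ((lam * (P p q * M p q) + P p q * Real.log (P p q)) +
        t * (auxD i k j l p q * (lam * M p q + Real.log (Q p q) + 1))) := by
    refine Finset.sum_le_sum fun p _ => Finset.sum_le_sum fun q _ => ?_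
    rcases key p q with h | h
    · have h3 := aux_tangent (P p q) (Q p q) (h0 p q) h
      have h4 : Q p q - P p q = t * auxD i k j l p q := by simp [hQ]
      have h5 : Q p q * M p q = P p q * M p q + t * auxD i k j l p q * M p q := by
        rw [← h4]; ring
      rw [h4] at h3
      rw [h5]
      linarith
    · have : Q p q = P p q := by simp [hQ, h]
      rw [this, h]; simp
  have h3 := h1.trans h2
  simp only [Finset.sum_add_distrib (f := fun q => lam * (P _ q * M _ q) + P _ q * Real.log (P _ q)),
    Finset.sum_add_distrib (f := fun p => ∑ q, (lam * (P p q * M p q) + P p q * Real.log (P p q))),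
    ← Finset.mul_sum] at h3
  rw [auxD_sum i k j l (fun p q => lam * M p q + Real.log (Q p q) + 1)] at h3
  have h4 := (mul_nonneg_iff_of_pos_left ht).1 (le_add_iff_nonneg_right _ |>.1 h3)
  rw [← e1, ← e2, ← e3, ← e4, ← Real.log_le_log_iff (by positivity) (by positivity),
    Real.log_mul (by positivity) (by positivity), Real.log_mul (by positivity) (by positivity),
    Real.log_mul (by positivity) (by positivity), Real.log_mul (by positivity) (by positivity),
    Real.log_exp, Real.log_exp]
  linarith

theorem aux_cross {d : ℕ}
    (M : Matrix (Fin d) (Fin d) ℝ) (lam : ℝ) (hlam : 0 < lam)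
    (r c : Fin d → ℝ)
    (P : Matrix (Fin d) (Fin d) ℝ)
    (hPmem : P ∈ transportPolytope r c)
    (hPmin : ∀ Q ∈ transportPolytope r c,
      frob P M - (1 / lam) * entMat P ≤ frob Q M - (1 / lam) * entMat Q)
    (i k j l : Fin d) (ha : 0 < P i l) (hb : 0 < P k j) :
    P i l * P k j * Real.exp (lam * (M i l + M k j)) ≤
      P i j * P k l * Real.exp (lam * (M i j + M k l)) := by
  by_cases hik : i = k
  · subst hik; apply le_of_eq; rw [add_comm (M i l)]; ring
  by_cases hjl : j = l
  · subst hjl; exact le_rfl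
  have c1 : Filter.Tendsto (fun t : ℝ => (P i l - t) * (P k j - t) *
      Real.exp (lam * (M i l + M k j))) (nhdsWithin 0 (Set.Ioi 0))
      (nhds ((P i l - 0) * (P k j - 0) * Real.exp (lam * (M i l + M k j)))) :=
    (Continuous.tendsto (by fun_prop) 0).mono_left nhdsWithin_le_nhds
  have c2 : Filter.Tendsto (fun t : ℝ => (P i j + t) * (P k l + t) *
      Real.exp (lam * (M i j + M k l))) (nhdsWithin 0 (Set.Ioi 0))
      (nhds ((P i j + 0) * (P k l + 0) * Real.exp (lam * (M i j + M k l)))) :=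
    (Continuous.tendsto (by fun_prop) 0).mono_left nhdsWithin_le_nhds
  have := le_of_tendsto_of_tendsto c1 c2 (by
    filter_upwards [Ioo_mem_nhdsGT (lt_min ha hb)] with t ht
    exact aux_step M lam hlam r c P hPmem hPmin i k j l hik hjl t ht.1
      (ht.2.trans_le (min_le_left _ _)) (ht.2.trans_le (min_le_right _ _)))
  simpa using this

/-- for positive marginals, the minimizer of the regularized problem
has positive entries and is a diagonal scaling of the entrywise exponential `e^{-λM}`. -/
theorem regularized_minimizer_diagonal_scaling {d : ℕ}
    (M : Matrix (Fin d) (Fin d) ℝ) (lam : ℝ) (hlam : 0 < lam)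
    (r c : Fin d → ℝ)
    (hr : r ∈ stdSimplex ℝ (Fin d)) (hc : c ∈ stdSimplex ℝ (Fin d))
    (hrpos : ∀ i, 0 < r i) (hcpos : ∀ j, 0 < c j)
    (P : Matrix (Fin d) (Fin d) ℝ)
    (hPmem : P ∈ transportPolytope r c)
    (hPmin : ∀ Q ∈ transportPolytope r c,
      frob P M - (1 / lam) * entMat P ≤ frob Q M - (1 / lam) * entMat Q) :
    (∀ i j, 0 < P i j) ∧
    ∃ u v : Fin d → ℝ, (∀ i, 0 < u i) ∧ (∀ j, 0 < v j) ∧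
      ∀ i j, P i j = u i * Real.exp (-lam * M i j) * v j := by
  have hcross := aux_cross M lam hlam r c P hPmem hPmin
  obtain ⟨h0, hrow, hcol⟩ := hPmem
  have hpos : ∀ i j, 0 < P i j := by
    intro i j
    obtain ⟨l, -, hl⟩ : ∃ l ∈ (Finset.univ : Finset (Fin d)), 0 < P i l :=
      Finset.exists_lt_of_sum_lt (f := fun _ => (0:ℝ)) (by rw [hrow]; simpa using hrpos i)
    obtain ⟨k, -, hk⟩ : ∃ k ∈ (Finset.univ : Finset (Fin d)), 0 < P k j :=
      Finset.exists_lt_of_sum_lt (f := fun _ => (0:ℝ)) (by rw [hcol]; simpa using hcpos j)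
    have h := hcross i k j l hl hk
    have h' : 0 < P i l * P k j * Real.exp (lam * (M i l + M k j)) := by positivity
    rcases (h0 i j).eq_or_lt with h1 | h1
    · rw [← h1] at h; simp at h; linarith
    · exact h1
  refine ⟨hpos, ?_⟩
  rcases isEmpty_or_nonempty (Fin d) with he | ⟨⟨o⟩⟩
  · exact ⟨fun _ => 1, fun _ => 1, fun _ => one_pos, fun _ => one_pos, fun i => he.elim i⟩
  refine ⟨fun i => P i o * Real.exp (lam * M i o),
    fun j => P o j * Real.exp (lam * M o j) / (P o o * Real.exp (lam * M o o)),
    fun i => mul_pos (hpos _ _) (Real.exp_pos _),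
    fun j => div_pos (mul_pos (hpos _ _) (Real.exp_pos _)) (mul_pos (hpos _ _) (Real.exp_pos _)),
    fun i j => ?_⟩
  have h := le_antisymm (hcross i o j o (hpos _ _) (hpos _ _))
    (hcross i o o j (hpos _ _) (hpos _ _))
  have hoo := (hpos o o).ne'
  simp only [mul_add, Real.exp_add] at h
  rw [neg_mul, Real.exp_neg]
  field_simp
  linarith
end
end

section
/- Let M ∈ 𝓜 be a metric matrix with m_{ij} > 0 whenever i ≠ j, and let r ∈ Σ_d have at least two strictly positive coordinates (equivalently h(r) > 0). Then the Sinkhorn distance at α = 0 from r to itself is strictly positive: d_{M,0}(r,r) = rᵀ M r > 0. In particular d_{M,α} fails the coincidence axiom for α small enough. -/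
open Real BigOperators Finset

noncomputable section

lemma kl_point (a b p : ℝ) (ha : 0 ≤ a) (hb : 0 ≤ b) (hp : 0 ≤ p)
    (h0a : a = 0 → p = 0) (h0b : b = 0 → p = 0) :
    0 ≤ p * Real.log p - p * (Real.log a + Real.log b) - p + a * b ∧
    (p * Real.log p - p * (Real.log a + Real.log b) - p + a * b = 0 → p = a * b) := by
  rcases hp.eq_or_lt with h | h
  · subst h
    simp only [zero_mul, sub_zero, zero_add]
    exact ⟨mul_nonneg ha hb, fun h => h.symm⟩
  have ha' : 0 < a := lt_of_le_of_ne ha (fun h' => h.ne' (h0a h'.symm))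
  have hb' : 0 < b := lt_of_le_of_ne hb (fun h' => h.ne' (h0b h'.symm))
  have hq : 0 < a * b / p := by positivity
  have hl : Real.log (a * b / p) = Real.log a + Real.log b - Real.log p := by
    rw [Real.log_div (by positivity) h.ne', Real.log_mul ha'.ne' hb'.ne']
  have e : p * (a * b / p) = a * b := by field_simp
  have key : p * Real.log p - p * (Real.log a + Real.log b) - p + a * b
      = p * (a * b / p - 1 - Real.log (a * b / p)) := by
    rw [hl, mul_sub, mul_sub, e]; ring
  rw [key]
  constructor
  · have := Real.log_le_sub_one_of_pos hq
    exact mul_nonneg hp (by linarith)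
  · intro h1
    by_contra hne
    have hne' : a * b / p ≠ 1 := by
      intro h3
      rw [h3, mul_one] at e
      exact hne e
    have := Real.log_lt_sub_one_of_pos hq hne'
    have := mul_pos h (show 0 < a * b / p - 1 - Real.log (a * b / p) by linarith)
    linarith

lemma cross_sum {d : ℕ} (r : Fin d → ℝ) (P : Matrix (Fin d) (Fin d) ℝ)
    (hP : P ∈ transportPolytope r r) :
    ∑ i, ∑ j, P i j * (Real.log (r i) + Real.log (r j)) = -(entVec r + entVec r) := by
  obtain ⟨_, h1, h2⟩ := hP
  simp only [mul_add, Finset.sum_add_distrib]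
  rw [Finset.sum_comm (f := fun i j => P i j * Real.log (r j))]
  simp only [← Finset.sum_mul, h1, h2, entVec]
  ring

def prodMat {d : ℕ} (r : Fin d → ℝ) : Matrix (Fin d) (Fin d) ℝ := Matrix.of fun i j => r i * r j

lemma prodMat_apply {d : ℕ} (r : Fin d → ℝ) (i j : Fin d) : prodMat r i j = r i * r j := rfl

lemma prodMat_mem {d : ℕ} (r : Fin d → ℝ) (hr : r ∈ stdSimplex ℝ (Fin d)) :
    (prodMat r) ∈ transportPolytope r r := by
  refine ⟨fun i j => mul_nonneg (hr.1 i) (hr.1 j), fun i => ?_, fun j => ?_⟩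
  · simp only [prodMat_apply]
    rw [← Finset.mul_sum, hr.2, mul_one]
  · simp only [prodMat_apply]
    rw [← Finset.sum_mul, hr.2, one_mul]

lemma Ualpha_zero {d : ℕ} (r : Fin d → ℝ) (hr : r ∈ stdSimplex ℝ (Fin d)) :
    Ualpha 0 r r = {(prodMat r)} := by
  ext P
  simp only [Set.mem_singleton_iff]
  constructor
  · rintro ⟨hP, hE⟩
    have hc := cross_sum r P hP
    obtain ⟨h0, h1, h2⟩ := hP
    have hk := fun i j => kl_point (r i) (r j) (P i j) (hr.1 i) (hr.1 j) (h0 i j)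
      (fun h => (Finset.sum_eq_zero_iff_of_nonneg (fun j _ => h0 i j)).1 ((h1 i).trans h) j
        (Finset.mem_univ _))
      (fun h => (Finset.sum_eq_zero_iff_of_nonneg (fun i _ => h0 i j)).1 ((h2 j).trans h) i
        (Finset.mem_univ _))
    have hs : ∑ i, ∑ j, (P i j * Real.log (P i j) - P i j * (Real.log (r i) + Real.log (r j))
        - P i j + r i * r j) ≤ 0 := by
      simp only [Finset.sum_add_distrib, Finset.sum_sub_distrib]
      rw [hc]
      simp only [h1, ← Finset.mul_sum, hr.2, mul_one]
      unfold entMat at hE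
      linarith
    have hn : ∀ i ∈ Finset.univ, 0 ≤ ∑ j, (P i j * Real.log (P i j)
        - P i j * (Real.log (r i) + Real.log (r j)) - P i j + r i * r j) :=
      fun i _ => Finset.sum_nonneg fun j _ => (hk i j).1
    have hz := (Finset.sum_eq_zero_iff_of_nonneg hn).1 (le_antisymm hs (Finset.sum_nonneg hn))
    ext i j
    exact (hk i j).2 ((Finset.sum_eq_zero_iff_of_nonneg (fun j _ => (hk i j).1)).1
      (hz i (Finset.mem_univ _)) j (Finset.mem_univ _))
  · rintro rfl
    refine ⟨prodMat_mem r hr, ?_⟩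
    have hc := cross_sum r _ (prodMat_mem r hr)
    have : entMat (prodMat r) = entVec r + entVec r := by
      rw [← neg_neg (entVec r + entVec r), ← hc, entMat]
      congr 1
      refine Finset.sum_congr rfl fun i _ => Finset.sum_congr rfl fun j _ => ?_
      rw [prodMat_apply]
      by_cases hi : r i = 0
      · simp [hi]
      by_cases hj : r j = 0
      · simp [hj]
      rw [Real.log_mul hi hj]
    rw [this]; simp

/-- at `α = 0`, `d_{M,0}(r,r) = rᵀ M r > 0` whenever `r` has at least
two strictly positive coordinates; so the coincidence axiom fails. -/
theorem sinkhorn_zero_self_pos {d : ℕ}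
    (M : Matrix (Fin d) (Fin d) ℝ) (hM : IsMetricMatrix M)
    (hMpos : ∀ i j, i ≠ j → 0 < M i j)
    (r : Fin d → ℝ) (hr : r ∈ stdSimplex ℝ (Fin d))
    (h2 : ∃ i j, i ≠ j ∧ 0 < r i ∧ 0 < r j) :
    sinkhornDist M 0 r r = (∑ i, ∑ j, r i * M i j * r j) ∧
    0 < sinkhornDist M 0 r r := by
  have he : sinkhornDist M 0 r r = ∑ i, ∑ j, r i * M i j * r j := by
    rw [sinkhornDist, Ualpha_zero r hr, Set.image_singleton, csInf_singleton, frob]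
    exact Finset.sum_congr rfl fun i _ => Finset.sum_congr rfl fun j _ => by rw [prodMat_apply]; ring
  refine ⟨he, ?_⟩
  rw [he]
  obtain ⟨i, j, hij, hi, hj⟩ := h2
  have hn : ∀ i j, 0 ≤ r i * M i j * r j := fun i j =>
    mul_nonneg (mul_nonneg (hr.1 i) (hM.1 i j)) (hr.1 j)
  refine Finset.sum_pos' (fun i _ => Finset.sum_nonneg fun j _ => hn i j)
    ⟨i, Finset.mem_univ _, Finset.sum_pos' (fun j _ => hn i j) ⟨j, Finset.mem_univ _, ?_⟩⟩
  exact mul_pos (mul_pos hi (hMpos i j hij)) hj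
end
end

section
/- Let M be a d×d real matrix and r, c ∈ Σ_d. For λ > 0, let P^λ denote the unique minimizer of P ↦ ⟨P,M⟩ − (1/λ) h(P) over U(r,c). Then the entropy of the minimizer is monotonically nonincreasing in λ: for 0 < λ₁ ≤ λ₂ one has h(P^{λ₁}) ≥ h(P^{λ₂}). -/
open Real BigOperators Finset

noncomputable section

lemma entMat_eq_negMulLog {d : ℕ} (P : Matrix (Fin d) (Fin d) ℝ) :
    entMat P = ∑ i, ∑ j, Real.negMulLog (P i j) := by
  simp [entMat, Real.negMulLog, Finset.sum_neg_distrib]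

lemma negMulLog_mid {x y : ℝ} (hx : 0 ≤ x) (hy : 0 ≤ y) :
    (1/2) * Real.negMulLog x + (1/2) * Real.negMulLog y
      ≤ Real.negMulLog ((1/2) * x + (1/2) * y) := by
  have := Real.concaveOn_negMulLog.2 (Set.mem_Ici.2 hx) (Set.mem_Ici.2 hy)
    (show (0:ℝ) ≤ 1/2 by norm_num) (show (0:ℝ) ≤ 1/2 by norm_num) (by norm_num)
  simpa only [smul_eq_mul] using this

lemma negMulLog_mid_lt {x y : ℝ} (hx : 0 ≤ x) (hy : 0 ≤ y) (h : x ≠ y) :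
    (1/2) * Real.negMulLog x + (1/2) * Real.negMulLog y
      < Real.negMulLog ((1/2) * x + (1/2) * y) := by
  have := Real.strictConcaveOn_negMulLog.2 (Set.mem_Ici.2 hx) (Set.mem_Ici.2 hy) h
    (show (0:ℝ) < 1/2 by norm_num) (show (0:ℝ) < 1/2 by norm_num) (by norm_num)
  simpa only [smul_eq_mul] using this

lemma entMat_mid_lt {d : ℕ} (P Q : Matrix (Fin d) (Fin d) ℝ) (hP : ∀ i j, 0 ≤ P i j)
    (hQ : ∀ i j, 0 ≤ Q i j) (h : P ≠ Q) :
    (1/2) * entMat P + (1/2) * entMat Q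
      < entMat (fun i j => (1/2) * P i j + (1/2) * Q i j) := by
  refine lt_of_lt_of_eq ?_ (entMat_eq_negMulLog _).symm
  rw [entMat_eq_negMulLog, entMat_eq_negMulLog]
  simp only [Finset.mul_sum, ← Finset.sum_add_distrib]
  obtain ⟨i, j, hij⟩ : ∃ i j, P i j ≠ Q i j := by
    by_contra! hh
    exact h (by ext i j; exact hh i j)
  refine Finset.sum_lt_sum (fun i _ => Finset.sum_le_sum fun j _ =>
    negMulLog_mid (hP i j) (hQ i j)) ⟨i, Finset.mem_univ _, ?_⟩
  exact Finset.sum_lt_sum (fun j _ => negMulLog_mid (hP i j) (hQ i j))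
    ⟨j, Finset.mem_univ _, negMulLog_mid_lt (hP i j) (hQ i j) hij⟩

/-- the entropy of the regularized minimizer is nonincreasing in `λ`. -/
theorem entropy_minimizer_antitone {d : ℕ}
    (M : Matrix (Fin d) (Fin d) ℝ) (r c : Fin d → ℝ)
    (hr : r ∈ stdSimplex ℝ (Fin d)) (hc : c ∈ stdSimplex ℝ (Fin d))
    (lam₁ lam₂ : ℝ) (h₁ : 0 < lam₁) (h₁₂ : lam₁ ≤ lam₂)
    (P₁ P₂ : Matrix (Fin d) (Fin d) ℝ)
    (hP₁mem : P₁ ∈ transportPolytope r c)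
    (hP₁min : ∀ Q ∈ transportPolytope r c,
      frob P₁ M - (1 / lam₁) * entMat P₁ ≤ frob Q M - (1 / lam₁) * entMat Q)
    (hP₂mem : P₂ ∈ transportPolytope r c)
    (hP₂min : ∀ Q ∈ transportPolytope r c,
      frob P₂ M - (1 / lam₂) * entMat P₂ ≤ frob Q M - (1 / lam₂) * entMat Q) :
    entMat P₂ ≤ entMat P₁ := by
  rcases h₁₂.eq_or_lt with he | hlt
  · subst he
    by_cases h : P₁ = P₂
    · rw [h]
    exfalso
    have hlt := entMat_mid_lt P₁ P₂ hP₁mem.1 hP₂mem.1 h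
    set Q : Matrix (Fin d) (Fin d) ℝ := fun i j => (1/2) * P₁ i j + (1/2) * P₂ i j with hQ
    have hQmem : Q ∈ transportPolytope r c := by
      obtain ⟨a1, a2, a3⟩ := hP₁mem
      obtain ⟨b1, b2, b3⟩ := hP₂mem
      refine ⟨fun i j => ?_, fun i => ?_, fun j => ?_⟩
      · have := a1 i j
        have := b1 i j
        simp only [hQ]
        positivity
      · simp only [hQ, Finset.sum_add_distrib, ← Finset.mul_sum, a2, b2]
        ring
      · simp only [hQ, Finset.sum_add_distrib, ← Finset.mul_sum, a3, b3]
        ring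
    have hf : frob Q M = (1/2) * frob P₁ M + (1/2) * frob P₂ M := by
      simp only [frob, hQ, Finset.mul_sum, ← Finset.sum_add_distrib]
      refine Finset.sum_congr rfl fun i _ => Finset.sum_congr rfl fun j _ => ?_
      ring
    have q1 := hP₁min Q hQmem
    have q2 := hP₂min Q hQmem
    have q3 := mul_lt_mul_of_pos_left hlt (one_div_pos.2 h₁)
    rw [hf] at q1 q2
    linarith
  · have q1 := hP₁min P₂ hP₂mem
    have q2 := hP₂min P₁ hP₁mem
    have q3 : 1 / lam₂ < 1 / lam₁ := one_div_lt_one_div_of_lt h₁ hlt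
    by_contra! hcon
    have := mul_pos (sub_pos.2 q3) (sub_pos.2 hcon)
    linarith
end
end

section
/- Let M ∈ 𝓜 be a metric matrix, let x, y, z ∈ Σ_d, let P ∈ U(x,y) and Q ∈ U(y,z), and let S be the d×d matrix with entries s_{ik} = Σ_{j : y_j > 0} p_{ij} q_{jk} / y_j. Then the transportation cost of the glued table is subadditive: ⟨S,M⟩ ≤ ⟨P,M⟩ + ⟨Q,M⟩. -/
open Real BigOperators Finset

noncomputable section

/-- subadditivity of the transportation cost of the glued table. -/
theorem glued_cost_subadditive {d : ℕ}
    (M : Matrix (Fin d) (Fin d) ℝ) (hM : IsMetricMatrix M)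
    (x y z : Fin d → ℝ)
    (hx : x ∈ stdSimplex ℝ (Fin d)) (hy : y ∈ stdSimplex ℝ (Fin d))
    (hz : z ∈ stdSimplex ℝ (Fin d))
    (P Q S : Matrix (Fin d) (Fin d) ℝ)
    (hP : P ∈ transportPolytope x y) (hQ : Q ∈ transportPolytope y z)
    (hS : ∀ i k, S i k = ∑ j ∈ Finset.univ.filter (fun j => 0 < y j), P i j * Q j k / y j) :
    frob S M ≤ frob P M + frob Q M := by
  obtain ⟨_, _, hT⟩ := hM
  obtain ⟨hP0, _, hPc⟩ := hP
  obtain ⟨hQ0, hQr, _⟩ := hQ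
  have hS' : ∀ i k, S i k = ∑ j, P i j * Q j k / y j := by
    intro i k
    rw [hS, Finset.sum_filter]
    refine Finset.sum_congr rfl fun j _ => ?_
    split_ifs with h
    · rfl
    · have h0 : y j = 0 := le_antisymm (not_lt.mp h) (hy.1 j)
      simp [h0]
  have hA : ∀ i j, ∑ k, P i j * Q j k / y j = P i j := by
    intro i j
    rw [← Finset.sum_div, ← Finset.mul_sum, hQr]
    by_cases h : y j = 0
    · have h1 := hPc j
      rw [h, Finset.sum_eq_zero_iff_of_nonneg (fun i _ => hP0 i j)] at h1
      simp [h1 i (Finset.mem_univ i)]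
    · field_simp
  have hB : ∀ j k, ∑ i, P i j * Q j k / y j = Q j k := by
    intro j k
    rw [← Finset.sum_div, ← Finset.sum_mul, hPc]
    by_cases h : y j = 0
    · have h1 := hQr j
      rw [h, Finset.sum_eq_zero_iff_of_nonneg (fun i _ => hQ0 j i)] at h1
      simp [h1 k (Finset.mem_univ k)]
    · field_simp
  have h1 : frob P M = ∑ i, ∑ k, ∑ j, P i j * Q j k / y j * M i j := by
    unfold frob
    refine Finset.sum_congr rfl fun i _ => ?_
    rw [Finset.sum_comm]
    refine Finset.sum_congr rfl fun j _ => ?_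
    rw [← Finset.sum_mul, hA]
  have h2 : frob Q M = ∑ i, ∑ k, ∑ j, P i j * Q j k / y j * M j k := by
    unfold frob
    rw [Finset.sum_comm]
    conv_rhs => rw [Finset.sum_comm]
    refine Finset.sum_congr rfl fun k _ => ?_
    conv_rhs => rw [Finset.sum_comm]
    refine Finset.sum_congr rfl fun j _ => ?_
    rw [← Finset.sum_mul, hB]
  rw [h1, h2, ← Finset.sum_add_distrib]
  unfold frob
  refine Finset.sum_le_sum fun i _ => ?_
  rw [← Finset.sum_add_distrib]
  refine Finset.sum_le_sum fun k _ => ?_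
  rw [← Finset.sum_add_distrib, hS', Finset.sum_mul]
  refine Finset.sum_le_sum fun j _ => ?_
  rw [← mul_add]
  exact mul_le_mul_of_nonneg_left (hT i k j)
    (div_nonneg (mul_nonneg (hP0 i j) (hQ0 j k)) (hy.1 j))
end
end
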